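/- For every integer k ≥ 1 and all z, w in the closed disk D of radius 1/2 centered at 0 in ℂ with z ≠ w, one has G_k(z) = G_k(w) if and only if w = −z, z ≠ 0, and p_k(z) = 0 (equivalently z = a_{k,j} for some integer j with 1 ≤ |j| ≤ k). In particular G_k is injective on the complement in D of the set {a_{k,j} : 1 ≤ |j| ≤ k}. -/

import Mathlib

/-- `p k z = ∏_{j=-k}^{k} (z - j/(3k))`. -/
noncomputable def p (k : ℕ) (z : ℂ) : ℂ :=
  ∏ j ∈ Finset.Icc (-(k : ℤ)) (k : ℤ), (z - (j : ℂ) / (3 * k))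

/-- `G k z = (z², p k z)`. -/
noncomputable def G (k : ℕ) (z : ℂ) : ℂ × ℂ := (z ^ 2, p k z)

/-- `p k` is an odd function. -/
theorem p_neg (k : ℕ) (z : ℂ) : p k (-z) = -p k z := by
  have h : p k (-z) =
      ∏ j ∈ Finset.Icc (-(k : ℤ)) (k : ℤ), -(z - (j : ℂ) / (3 * k)) := by
    unfold p
    refine Finset.prod_bij' (fun j _ => -j) (fun j _ => -j) ?_ ?_ ?_ ?_ ?_
    · intro j hj
      rw [Finset.mem_Icc] at hj ⊢
      omega
    · intro j hj
      rw [Finset.mem_Icc] at hj ⊢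
      omega
    · simp
    · simp
    · intro j _
      push_cast
      ring
  have hcard : (Finset.Icc (-(k : ℤ)) (k : ℤ)).card = 2 * k + 1 := by
    rw [Int.card_Icc]
    omega
  rw [h, Finset.prod_neg, hcard, Odd.neg_one_pow ⟨k, rfl⟩, neg_one_mul, p]

theorem p_eq_zero_iff (k : ℕ) (z : ℂ) :
    p k z = 0 ↔ ∃ j : ℤ, |j| ≤ (k : ℤ) ∧ z = (j : ℂ) / (3 * k) := by
  simp only [p, Finset.prod_eq_zero_iff, Finset.mem_Icc, sub_eq_zero, abs_le]

theorem G_eq_iff_of_ne (k : ℕ) {z w : ℂ} (hne : z ≠ w) :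
    G k z = G k w ↔ w = -z ∧ z ≠ 0 ∧ p k z = 0 := by
  simp only [G, Prod.mk.injEq]
  constructor
  · rintro ⟨hsq, hp⟩
    obtain rfl : w = -z := (sq_eq_sq_iff_eq_or_eq_neg.mp hsq.symm).resolve_left hne.symm
    refine ⟨rfl, ?_, ?_⟩
    · rintro rfl
      simp at hne
    · rwa [p_neg, self_eq_neg] at hp
  · rintro ⟨rfl, -, hp⟩
    simp [p_neg, hp]

theorem ne_zero_and_p_eq_zero_iff {k : ℕ} (hk : 1 ≤ k) (z : ℂ) :
    (z ≠ 0 ∧ p k z = 0) ↔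
      ∃ j : ℤ, 1 ≤ |j| ∧ |j| ≤ (k : ℤ) ∧ z = (j : ℂ) / (3 * k) := by
  have hk' : (k : ℂ) ≠ 0 := by exact_mod_cast (by omega : k ≠ 0)
  rw [p_eq_zero_iff]
  constructor
  · rintro ⟨hz, j, hj, rfl⟩
    refine ⟨j, Int.one_le_abs ?_, hj, rfl⟩
    rintro rfl
    simp at hz
  · rintro ⟨j, hj1, hj, rfl⟩
    have hj0 : j ≠ 0 := by
      rintro rfl
      simp at hj1
    have hj0' : (j : ℂ) ≠ 0 := by exact_mod_cast hj0
    exact ⟨div_ne_zero hj0' (mul_ne_zero three_ne_zero hk'), j, hj, rfl⟩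

theorem stmt_8 (k : ℕ) (hk : 1 ≤ k) :
    (∀ z ∈ Metric.closedBall (0 : ℂ) (1 / 2),
      ∀ w ∈ Metric.closedBall (0 : ℂ) (1 / 2), z ≠ w →
        (G k z = G k w ↔ (w = -z ∧ z ≠ 0 ∧ p k z = 0))) ∧
    (∀ z : ℂ, (z ≠ 0 ∧ p k z = 0) ↔
        ∃ j : ℤ, 1 ≤ |j| ∧ |j| ≤ (k : ℤ) ∧ z = (j : ℂ) / (3 * k)) ∧
    Set.InjOn (G k)
      (Metric.closedBall (0 : ℂ) (1 / 2) \
        {z : ℂ | ∃ j : ℤ, 1 ≤ |j| ∧ |j| ≤ (k : ℤ) ∧ z = (j : ℂ) / (3 * k)}) := by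
  refine ⟨fun z _ w _ hne => G_eq_iff_of_ne k hne, ne_zero_and_p_eq_zero_iff hk, ?_⟩
  rintro z ⟨-, hz⟩ w - hG
  by_contra hne
  exact hz ((ne_zero_and_p_eq_zero_iff hk z).mp ((G_eq_iff_of_ne k hne).mp hG).2)
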